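/- arXiv:2112.12495 — 4 statements merged into one kernel-verified Lean document; each statement's English description precedes it below -/
import Mathlib

section
/- Let m ≥ 2, let s with 1 ≤ s ≤ m, and let B_0, …, B_{l-1} be a partition of {0, …, m−1} into blocks such that the block containing 0 is B_{l-1} = {0, …, s−1}. Let C be a monomial code on m variables that is invariant under every permutation π of the variables {x_0, …, x_{m−1}} that maps each block B_t to itself. Then both the partial-derivative code C⁽⁻⁾ and the code C⁽⁺⁾ with respect to the variable x_0 (codes on the m−1 variables x_1, …, x_{m−1}) are invariant under every permutation of the variables {x_1, …, x_{m−1}} that maps each of the blocks B_0, …, B_{l-2} and {1, …, s−1} to itself. -/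
/-- Boolean functions in `m` variables. -/
abbrev BF (m : ℕ) := (Fin m → ZMod 2) → ZMod 2

/-- The monomial `x^v`. -/
def monomialBF {m : ℕ} (v : Fin m → ZMod 2) : BF m :=
  fun x => ∏ i, x i ^ (v i).val

/-- The monomial code generated by the exponent set `V`. -/
def monomialCode {m : ℕ} (V : Set (Fin m → ZMod 2)) : Submodule (ZMod 2) (BF m) :=
  Submodule.span (ZMod 2) (monomialBF '' V)

/-- The action of a variable permutation on Boolean functions:
`(π · f)(x₀, …, x_{m-1}) = f(x_{π 0}, …, x_{π (m-1)})`. -/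
def permAction {m : ℕ} (π : Equiv.Perm (Fin m)) : BF m →ₗ[ZMod 2] BF m where
  toFun f := fun x => f (x ∘ π)
  map_add' _ _ := rfl
  map_smul' _ _ := rfl

/-- The derivative in direction `b`: `(D_b f)(x) = f(x + b) + f(x)`. -/
def derivBF {m : ℕ} (b : Fin m → ZMod 2) : BF m →ₗ[ZMod 2] BF m where
  toFun f := fun x => f (x + b) + f x
  map_add' f g := by funext x; show (f + g) (x + b) + (f + g) x = _; simp [Pi.add_apply]; ring
  map_smul' c f := by funext x; show (c • f) (x + b) + (c • f) x = _; simp [Pi.smul_apply]; ring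

/-- Restriction of a Boolean function in `m = n+1` variables to the points with `x_i = 0`,
viewed as a Boolean function of the remaining `n` variables. -/
def restrictZero {n : ℕ} (i : Fin (n + 1)) : BF (n + 1) →ₗ[ZMod 2] BF n where
  toFun f := fun y => f (i.insertNth 0 y)
  map_add' _ _ := rfl
  map_smul' _ _ := rfl

/-- The partial-derivative code `C⁽⁻⁾` with respect to the variable `x_i`. -/
def codeMinus {n : ℕ} (i : Fin (n + 1)) (C : Submodule (ZMod 2) (BF (n + 1))) :
    Submodule (ZMod 2) (BF n) :=
  Submodule.map (restrictZero i ∘ₗ derivBF (Pi.single i 1)) C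

/-- The code `C⁽⁺⁾` with respect to the variable `x_i`. -/
def codePlus {n : ℕ} (i : Fin (n + 1)) (C : Submodule (ZMod 2) (BF (n + 1))) :
    Submodule (ZMod 2) (BF n) :=
  Submodule.map (restrictZero i) (C ⊓ LinearMap.ker (derivBF (Pi.single i 1)))

theorem permAction_injective {m : ℕ} (π : Equiv.Perm (Fin m)) :
    Function.Injective (permAction π) := by
  intro f g h
  funext x
  have hx := congrFun h (x ∘ π.symm)
  simpa [permAction, Function.comp_assoc] using hx

/-- The extension of a permutation of `Fin n` to `Fin (n + 1)` that fixes `0`. -/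
def extendPerm {n : ℕ} (σ : Equiv.Perm (Fin n)) : Equiv.Perm (Fin (n + 1)) :=
  Equiv.Perm.decomposeFin.symm (0, σ)

theorem extendPerm_zero {n : ℕ} (σ : Equiv.Perm (Fin n)) : extendPerm σ 0 = 0 := by
  simp [extendPerm]

theorem extendPerm_succ {n : ℕ} (σ : Equiv.Perm (Fin n)) (j : Fin n) :
    extendPerm σ j.succ = (σ j).succ := by
  simp [extendPerm]

theorem derivBF_comp_permAction {m : ℕ} (π : Equiv.Perm (Fin m)) (b : Fin m → ZMod 2)
    (hb : b ∘ π = b) :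
    derivBF b ∘ₗ permAction π = permAction π ∘ₗ derivBF b := by
  refine LinearMap.ext fun f => funext fun x => ?_
  change f ((x + b) ∘ π) + f (x ∘ π) = f (x ∘ π + b) + f (x ∘ π)
  rw [Pi.add_comp, hb]

theorem single_zero_comp_extendPerm {n : ℕ} (σ : Equiv.Perm (Fin n)) :
    (Pi.single 0 1 : Fin (n + 1) → ZMod 2) ∘ extendPerm σ = Pi.single 0 1 := by
  funext k
  refine Fin.cases ?_ (fun j => ?_) k
  · simp [extendPerm_zero]
  · simp [extendPerm_succ]

theorem restrictZero_comp_permAction {n : ℕ} (σ : Equiv.Perm (Fin n)) :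
    restrictZero 0 ∘ₗ permAction (extendPerm σ) = permAction σ ∘ₗ restrictZero 0 := by
  refine LinearMap.ext fun f => funext fun y => congrArg f (funext fun k => ?_)
  refine Fin.cases ?_ (fun j => ?_) k
  · simp [extendPerm_zero]
  · simp [extendPerm_succ]

theorem map_permAction_ker_derivBF {m : ℕ} (π : Equiv.Perm (Fin m)) (b : Fin m → ZMod 2)
    (hb : b ∘ π = b) :
    Submodule.map (permAction π) (LinearMap.ker (derivBF b)) = LinearMap.ker (derivBF b) := by
  have hcomm (f : BF m) : derivBF b (permAction π f) = permAction π (derivBF b f) :=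
    LinearMap.congr_fun (derivBF_comp_permAction π b hb) f
  ext f
  simp only [Submodule.mem_map, LinearMap.mem_ker]
  constructor
  · rintro ⟨g, hg, rfl⟩
    rw [hcomm, hg, map_zero]
  · intro hf
    obtain ⟨g, rfl⟩ : ∃ g, permAction π g = f :=
      ⟨permAction π.symm f, by funext x; simp [permAction, Function.comp_assoc]⟩
    exact ⟨g, permAction_injective π (by rw [← hcomm, hf, map_zero]), rfl⟩

theorem map_permAction_codeMinus {n : ℕ} (σ : Equiv.Perm (Fin n))
    (C : Submodule (ZMod 2) (BF (n + 1))) :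
    Submodule.map (permAction σ) (codeMinus 0 C) =
      codeMinus 0 (Submodule.map (permAction (extendPerm σ)) C) := by
  simp only [codeMinus, ← Submodule.map_comp]
  rw [LinearMap.comp_assoc, derivBF_comp_permAction _ _ (single_zero_comp_extendPerm σ),
    ← LinearMap.comp_assoc, ← LinearMap.comp_assoc, restrictZero_comp_permAction]

theorem map_permAction_codePlus {n : ℕ} (σ : Equiv.Perm (Fin n))
    (C : Submodule (ZMod 2) (BF (n + 1))) :
    Submodule.map (permAction σ) (codePlus 0 C) =
      codePlus 0 (Submodule.map (permAction (extendPerm σ)) C) := by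
  simp only [codePlus]
  rw [← Submodule.map_comp, ← restrictZero_comp_permAction, Submodule.map_comp,
    Submodule.map_inf _ (permAction_injective _),
    map_permAction_ker_derivBF _ _ (single_zero_comp_extendPerm σ)]

/-- Let `m = n + 1 ≥ 2`, let `1 ≤ s ≤ m`, and let `blk : Fin m → ℕ` describe a
partition of the variable indices into blocks (the fibers of `blk`), such that the block
containing the index `0` is exactly `{0, …, s-1}`.  If the monomial code `C(V)` is invariant
under every permutation of variables mapping each block to itself, then both `C⁽⁻⁾` and `C⁽⁺⁾`
with respect to the variable `x_0` (codes on the variables `x_1, …, x_{m-1}`, reindexed via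
`Fin.succ`) are invariant under every permutation of `{x_1, …, x_{m-1}}` mapping each of the
induced blocks (the old blocks not containing `0`, together with `{1, …, s-1}`) to itself. -/
theorem polar_step_symmetry (n : ℕ) (hn : 1 ≤ n) (s : ℕ) (hs1 : 1 ≤ s) (hsm : s ≤ n + 1)
    (blk : Fin (n + 1) → ℕ)
    (hblk0 : ∀ k : Fin (n + 1), blk k = blk 0 ↔ (k : ℕ) < s)
    (V : Set (Fin (n + 1) → ZMod 2))
    (hinv : ∀ π : Equiv.Perm (Fin (n + 1)), (∀ k, blk (π k) = blk k) →
      Submodule.map (permAction π) (monomialCode V) = monomialCode V) :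
    ∀ σ : Equiv.Perm (Fin n), (∀ j : Fin n, blk (σ j).succ = blk j.succ) →
      Submodule.map (permAction σ) (codeMinus 0 (monomialCode V))
          = codeMinus 0 (monomialCode V) ∧
      Submodule.map (permAction σ) (codePlus 0 (monomialCode V))
          = codePlus 0 (monomialCode V) := by
  intro σ hσ
  have hC := hinv (extendPerm σ) fun k => by
    refine Fin.cases ?_ (fun j => ?_) k
    · rw [extendPerm_zero]
    · rw [extendPerm_succ, hσ]
  rw [map_permAction_codeMinus, map_permAction_codePlus, hC]
  exact ⟨rfl, rfl⟩
end

section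
/- Let V ⊆ 𝔽₂^m with m ≥ 1 and let i ∈ {0, …, m−1}. The partial-derivative code C(V)⁽⁻⁾ with respect to the variable x_i equals the monomial code on the m−1 variables {x_j : j ≠ i} whose exponent set is {v restricted to the coordinates ≠ i : v ∈ V, v_i = 1}. -/
/-- The value of a monomial on a point with coordinate `x_i = a` split off. -/
lemma monomialBF_insertNth {n : ℕ} (i : Fin (n + 1)) (v : Fin (n + 1) → ZMod 2) (a : ZMod 2)
    (y : Fin n → ZMod 2) :
    monomialBF v (i.insertNth a y) = a ^ (v i).val * monomialBF (v ∘ i.succAbove) y := by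
  simp [monomialBF, Fin.prod_univ_succAbove _ i]

lemma insertNth_zero_add_single {n : ℕ} (i : Fin (n + 1)) (y : Fin n → ZMod 2) :
    (i.insertNth 0 y + Pi.single i 1 : Fin (n + 1) → ZMod 2) = i.insertNth 1 y := by
  ext j
  obtain rfl | ⟨k, rfl⟩ := i.eq_self_or_eq_succAbove j <;> simp

/-- The partial derivative of a monomial vanishes unless the variable `x_i` occurs in it, in which
case it removes that variable. -/
lemma restrictZero_derivBF_monomialBF {n : ℕ} (i : Fin (n + 1)) (v : Fin (n + 1) → ZMod 2) :
    restrictZero i (derivBF (Pi.single i 1) (monomialBF v)) =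
      if v i = 1 then monomialBF (v ∘ i.succAbove) else 0 := by
  funext y
  simp only [restrictZero, derivBF, LinearMap.coe_mk, AddHom.coe_mk]
  rw [insertNth_zero_add_single, monomialBF_insertNth, monomialBF_insertNth]
  obtain h | h : v i = 0 ∨ v i = 1 := by
    generalize v i = a
    revert a
    decide
  · simp [h, CharTwo.add_self_eq_zero]
  · simp [h, ZMod.val_one]

/-- For `V ⊆ 𝔽₂^m` with `m = n + 1 ≥ 1` and `i < m`, the partial-derivative
code `C(V)⁽⁻⁾` with respect to the variable `x_i` equals the monomial code on the `m - 1`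
remaining variables (reindexed via `Fin.succAbove i`) whose exponent set is
`{v restricted to the coordinates ≠ i : v ∈ V, v_i = 1}`. -/
theorem codeMinus_monomialCode (n : ℕ) (i : Fin (n + 1)) (V : Set (Fin (n + 1) → ZMod 2)) :
    codeMinus i (monomialCode V) =
      monomialCode ((fun v : Fin (n + 1) → ZMod 2 => v ∘ i.succAbove) ''
        {v | v ∈ V ∧ v i = 1}) := by
  rw [codeMinus, monomialCode, monomialCode, Submodule.map_span]
  apply le_antisymm <;> rw [Submodule.span_le]
  · rintro _ ⟨_, ⟨v, hv, rfl⟩, rfl⟩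
    rw [LinearMap.comp_apply, restrictZero_derivBF_monomialBF]
    split_ifs with h
    · exact Submodule.subset_span ⟨_, ⟨v, ⟨hv, h⟩, rfl⟩, rfl⟩
    · exact Submodule.zero_mem _
  · rintro _ ⟨_, ⟨v, ⟨hv, h⟩, rfl⟩, rfl⟩
    refine Submodule.subset_span ⟨_, ⟨v, hv, rfl⟩, ?_⟩
    rw [LinearMap.comp_apply, restrictZero_derivBF_monomialBF, if_pos h]
end

section
/- Let V ⊆ 𝔽₂^m with m ≥ 1 and let i ∈ {0, …, m−1}. Then dim C(V) = |V|, and dim C(V) = dim C(V)⁽⁻⁾ + dim C(V)⁽⁺⁾, where C(V)⁽⁻⁾ and C(V)⁽⁺⁾ are taken with respect to the variable x_i. -/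
/-- The indicator function of a point is a combination of monomials. -/
lemma single_mem_span_monomialBF {m : ℕ} (a : Fin m → ZMod 2) :
    (Pi.single a 1 : BF m) ∈ Submodule.span (ZMod 2) (Set.range (monomialBF (m := m))) := by
  have key : (Pi.single a 1 : BF m) =
      ∑ s ∈ (Finset.univ : Finset (Fin m)).powerset,
        (∏ j ∈ Finset.univ \ s, (a j + 1)) •
          monomialBF (fun j => if j ∈ s then (1 : ZMod 2) else 0) := by
    funext x
    have hmon (s : Finset (Fin m)) :
        monomialBF (fun j => if j ∈ s then (1 : ZMod 2) else 0) x = ∏ j ∈ s, x j := by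
      have hpow (j : Fin m) :
          x j ^ (if j ∈ s then (1 : ZMod 2) else 0).val = if j ∈ s then x j else 1 := by
        split_ifs <;> simp [ZMod.val_one]
      simp [monomialBF, hpow]
    have hfactor : ∀ u v : ZMod 2, u + (v + 1) = if u = v then 1 else 0 := by decide
    have hexp := Finset.prod_add (fun j => x j) (fun j => a j + 1) Finset.univ
    simp only [hfactor] at hexp
    simp only [Finset.sum_apply, Pi.smul_apply, smul_eq_mul, hmon, mul_comm (∏ j ∈ _ \ _, _),
      ← hexp, Pi.single_apply, Finset.prod_ite_zero, Finset.mem_univ, true_imp_iff,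
      Finset.prod_const_one, funext_iff]
  rw [key]
  exact Submodule.sum_mem _ fun s _ =>
    Submodule.smul_mem _ _ (Submodule.subset_span ⟨_, rfl⟩)

lemma span_range_monomialBF (m : ℕ) :
    Submodule.span (ZMod 2) (Set.range (monomialBF (m := m))) = ⊤ := by
  rw [eq_top_iff, ← (Pi.basisFun (ZMod 2) (Fin m → ZMod 2)).span_eq, Submodule.span_le]
  rintro _ ⟨a, rfl⟩
  simpa using single_mem_span_monomialBF a

lemma linearIndependent_monomialBF (m : ℕ) :
    LinearIndependent (ZMod 2) (monomialBF (m := m)) :=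
  linearIndependent_of_top_le_span_of_card_eq_finrank (span_range_monomialBF m).ge (by simp)

lemma finrank_monomialCode {m : ℕ} (V : Set (Fin m → ZMod 2)) :
    Module.finrank (ZMod 2) (monomialCode V) = Nat.card V := by
  have hV : LinearIndependent (ZMod 2) (fun v : V => monomialBF (v : Fin m → ZMod 2)) :=
    (linearIndependent_monomialBF m).comp _ Subtype.val_injective
  have := Fintype.ofFinite V
  rw [monomialCode, Set.image_eq_range, finrank_span_eq_card hV, Nat.card_eq_fintype_card]

/-- Rank-nullity for the restriction of a linear map to a subspace. -/
lemma Submodule.finrank_map_add_finrank_inf_ker {K E F : Type*} [DivisionRing K]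
    [AddCommGroup E] [Module K E] [FiniteDimensional K E] [AddCommGroup F] [Module K F]
    (f : E →ₗ[K] F) (C : Submodule K E) :
    Module.finrank K (C.map f) + Module.finrank K (C ⊓ LinearMap.ker f : Submodule K E) =
      Module.finrank K C := by
  have h := (f.domRestrict C).finrank_range_add_finrank_ker
  rw [LinearMap.range_domRestrict, LinearMap.ker_domRestrict] at h
  rw [← h, ← Submodule.map_comap_subtype,
    (Submodule.equivMapOfInjective C.subtype C.injective_subtype _).finrank_eq]

/-- A Boolean function that is invariant under flipping `x_i` is determined by its values on the
points with `x_i = 0`. -/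
lemma eq_zero_of_derivBF_eq_zero {n : ℕ} (i : Fin (n + 1)) {f : BF (n + 1)}
    (hf : derivBF (Pi.single i 1) f = 0) (h : restrictZero i f = 0) : f = 0 := by
  have hzero (y : Fin n → ZMod 2) : f (i.insertNth 0 y) = 0 := congrFun h y
  funext x
  obtain ⟨t, y, rfl⟩ : ∃ t y, x = i.insertNth (α := fun _ => ZMod 2) t y :=
    ⟨x i, i.removeNth x, (Fin.insertNth_self_removeNth i x).symm⟩
  obtain rfl | rfl : t = 0 ∨ t = 1 := by revert t; decide
  · exact hzero y
  · have hd : f (i.insertNth 0 y + Pi.single i 1) + f (i.insertNth 0 y) = 0 :=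
      congrFun hf (i.insertNth 0 y)
    have hflip : (i.insertNth 0 y + Pi.single i 1 : Fin (n + 1) → ZMod 2) =
        i.insertNth (α := fun _ => ZMod 2) 1 y := by
      funext j
      refine Fin.succAboveCases i ?_ (fun k => ?_) j <;> simp
    rwa [hflip, hzero, add_zero] at hd

lemma derivBF_derivBF {m : ℕ} (b : Fin m → ZMod 2) (f : BF m) :
    derivBF b (derivBF b f) = 0 := by
  funext x
  change f (x + b + b) + f (x + b) + (f (x + b) + f x) = 0
  have hb : b + b = 0 := funext fun j => CharTwo.add_self_eq_zero (b j)
  rw [add_assoc x, hb, add_zero, add_comm (f x), CharTwo.add_self_eq_zero]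

lemma ker_restrictZero_comp_derivBF {n : ℕ} (i : Fin (n + 1)) :
    LinearMap.ker (restrictZero i ∘ₗ derivBF (Pi.single i 1)) =
      LinearMap.ker (derivBF (Pi.single i 1)) :=
  le_antisymm (fun f hf => eq_zero_of_derivBF_eq_zero i (derivBF_derivBF _ f) hf)
    (LinearMap.ker_le_ker_comp _ _)

lemma finrank_codeMinus_add_finrank_codePlus {n : ℕ} (i : Fin (n + 1))
    (C : Submodule (ZMod 2) (BF (n + 1))) :
    Module.finrank (ZMod 2) (codeMinus i C) + Module.finrank (ZMod 2) (codePlus i C) =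
      Module.finrank (ZMod 2) C := by
  have hplus := Submodule.finrank_map_add_finrank_inf_ker (restrictZero i)
    (C ⊓ LinearMap.ker (derivBF (Pi.single i 1)))
  have hbot : C ⊓ LinearMap.ker (derivBF (Pi.single i 1)) ⊓ LinearMap.ker (restrictZero i) = ⊥ :=
    (Submodule.eq_bot_iff _).2 fun f hf => eq_zero_of_derivBF_eq_zero i hf.1.2 hf.2
  rw [hbot, finrank_bot, add_zero] at hplus
  rw [codePlus, hplus, ← ker_restrictZero_comp_derivBF]
  exact Submodule.finrank_map_add_finrank_inf_ker _ C

/-- For `V ⊆ 𝔽₂^m` with `m = n + 1 ≥ 1` and `i < m`, the dimension of the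
monomial code `C(V)` equals `|V|`, and `dim C(V) = dim C(V)⁽⁻⁾ + dim C(V)⁽⁺⁾`, where the codes
`C(V)⁽⁻⁾` and `C(V)⁽⁺⁾` are taken with respect to the variable `x_i`. -/
theorem monomialCode_finrank (n : ℕ) (i : Fin (n + 1)) (V : Set (Fin (n + 1) → ZMod 2)) :
    Module.finrank (ZMod 2) (monomialCode V) = Nat.card V ∧
    Module.finrank (ZMod 2) (monomialCode V) =
      Module.finrank (ZMod 2) (codeMinus i (monomialCode V)) +
      Module.finrank (ZMod 2) (codePlus i (monomialCode V)) :=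
  ⟨finrank_monomialCode V, (finrank_codeMinus_add_finrank_codePlus i _).symm⟩
end

section
/- Let V ⊆ 𝔽₂^m be a decreasing set of exponent vectors. Then the monomial code C(V) is invariant under every affine permutation of 𝔽₂^m of the form x ↦ Ax + b with A an invertible lower-triangular matrix over 𝔽₂ (A_{ij} = 0 for j > i) and b ∈ 𝔽₂^m; that is, for every such A and b, the substitution f(x) ↦ f(Ax + b) maps C(V) onto itself. -/
/-- The support of an exponent vector `v`, i.e. the set of variables occurring in `x^v`. -/
def suppBF {m : ℕ} (v : Fin m → ZMod 2) : Finset (Fin m) :=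
  Finset.univ.filter (fun i => v i = 1)

/-- The partial order on monomials of the same degree: writing
`x^t = x_{i_0} ⋯ x_{i_{w-1}}` and `x^v = x_{j_0} ⋯ x_{j_{w-1}}` with the indices listed in
increasing order, `x^t ≼ x^v` iff `i_q ≤ j_q` for all `q`. -/
def sdLE {m : ℕ} (t v : Fin m → ZMod 2) : Prop :=
  ∃ h : (suppBF t).card = (suppBF v).card,
    ∀ q : Fin (suppBF v).card,
      (((suppBF t).orderIsoOfFin h q : Fin m)) ≤ (((suppBF v).orderIsoOfFin rfl q : Fin m))

/-- The partial order `≼` on monomials, extending the same-degree order through divisibility: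
`x^t ≼ x^v` iff `x^t` divides a monomial `x^{t'}` of the same degree as `x^v` with
`x^{t'} ≼ x^v` in the same-degree order. -/
def monLE {m : ℕ} (t v : Fin m → ZMod 2) : Prop :=
  ∃ t' : Fin m → ZMod 2, suppBF t ⊆ suppBF t' ∧ sdLE t' v

/-- A set `V` of exponent vectors (equivalently, the monomial code `C(V)`) is decreasing if
whenever `v ∈ V` and `x^t ≼ x^v`, also `t ∈ V`. -/
def IsDecreasingSet {m : ℕ} (V : Set (Fin m → ZMod 2)) : Prop :=
  ∀ v ∈ V, ∀ t : Fin m → ZMod 2, monLE t v → t ∈ V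

/-- The substitution `f(x) ↦ f(Ax + b)` induced by an affine map, as a linear endomorphism of
the space of Boolean functions. -/
def substAff {m : ℕ} (A : Matrix (Fin m) (Fin m) (ZMod 2)) (b : Fin m → ZMod 2) :
    BF m →ₗ[ZMod 2] BF m where
  toFun f := fun x => f (A.mulVec x + b)
  map_add' _ _ := rfl
  map_smul' _ _ := rfl

/-- The number of elements of `S` with index at least `k`. -/
def tailCount {m : ℕ} (S : Finset (Fin m)) (k : ℕ) : ℕ :=
  (S.filter (fun i : Fin m => k ≤ (i : ℕ))).card

theorem tailCount_zero {m : ℕ} (S : Finset (Fin m)) : tailCount S 0 = S.card := by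
  simp [tailCount]

theorem tailCount_insert_le {m : ℕ} (S : Finset (Fin m)) (j : Fin m) (k : ℕ) :
    tailCount (insert j S) k ≤ tailCount S k + if k ≤ (j : ℕ) then 1 else 0 := by
  unfold tailCount
  rw [Finset.filter_insert]
  split_ifs
  · exact Finset.card_insert_le _ _
  · simp

theorem tailCount_insert {m : ℕ} {S : Finset (Fin m)} {j : Fin m} (hj : j ∉ S) (k : ℕ) :
    tailCount (insert j S) k = tailCount S k + if k ≤ (j : ℕ) then 1 else 0 := by
  unfold tailCount
  rw [Finset.filter_insert]
  split_ifs
  · exact Finset.card_insert_of_notMem (by simp [hj])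
  · simp

theorem card_le_tailCount_add {m : ℕ} (S : Finset (Fin m)) (k : ℕ) :
    S.card ≤ tailCount S k + k := by
  have h := Finset.card_filter_add_card_filter_not (s := S) (fun i : Fin m => k ≤ (i : ℕ))
  have h2 : (S.filter (fun i : Fin m => ¬ k ≤ (i : ℕ))).card ≤ (Finset.range k).card :=
    Finset.card_le_card_of_injOn (fun i => (i : ℕ))
      (fun i hi => by
        have := (Finset.mem_filter.1 hi).2
        simpa using this)
      (fun a _ b _ hab => Fin.ext hab)
  rw [Finset.card_range] at h2
  unfold tailCount
  omega

/-- If every index below `k` lies in `S`, the bound `card_le_tailCount_add` is attained. -/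
theorem card_eq_tailCount_add {m : ℕ} (S : Finset (Fin m)) (k : ℕ) (hk : k ≤ m)
    (h : ∀ i : Fin m, (i : ℕ) < k → i ∈ S) : S.card = tailCount S k + k := by
  refine le_antisymm (card_le_tailCount_add S k) ?_
  have h1 := Finset.card_filter_add_card_filter_not (s := S) (fun i : Fin m => k ≤ (i : ℕ))
  have h2 : (Finset.univ : Finset (Fin k)).card ≤
      (S.filter (fun i : Fin m => ¬ k ≤ (i : ℕ))).card :=
    Finset.card_le_card_of_injOn (fun i => Fin.castLE hk i)
      (fun i _ => by simp [h (Fin.castLE hk i) i.2])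
      (fun a _ b _ hab => Fin.castLE_injective hk hab)
  rw [Finset.card_univ, Fintype.card_fin] at h2
  unfold tailCount
  omega

/-- A set whose tail counts are dominated by those of `S` extends to one of the same size as `S`,
still dominated. -/
theorem exists_superset_tailCount_le {m : ℕ} (S T : Finset (Fin m))
    (h : ∀ k, tailCount T k ≤ tailCount S k) :
    ∃ T', T ⊆ T' ∧ T'.card = S.card ∧ ∀ k, tailCount T' k ≤ tailCount S k := by
  induction hd : S.card - T.card generalizing T with
  | zero =>
    have h0 := h 0
    rw [tailCount_zero, tailCount_zero] at h0
    exact ⟨T, subset_rfl, by omega, h⟩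
  | succ d ih =>
    have hne : (Finset.univ.filter (fun i => i ∉ T)).Nonempty := by
      by_contra hcon
      rw [Finset.not_nonempty_iff_eq_empty, Finset.filter_eq_empty_iff] at hcon
      have : S ⊆ T := fun i _ => not_not.1 (hcon (Finset.mem_univ i))
      have := Finset.card_le_card this
      omega
    obtain ⟨a, ha, hmin⟩ := Finset.exists_min_image _ id hne
    have haT : a ∉ T := (Finset.mem_filter.1 ha).2
    have hcard := Finset.card_insert_of_notMem haT
    obtain ⟨T', hsub, hc, ht⟩ := ih (insert a T) (fun k => by
      have hins := tailCount_insert haT k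
      split_ifs at hins with hka
      · have h1 := card_eq_tailCount_add (insert a T) k (by omega) (fun i hi => by
          by_contra hcon
          have : (a : ℕ) ≤ i := hmin i (by simp_all)
          omega)
        have h2 := card_le_tailCount_add S k
        omega
      · have := h k
        omega) (by omega)
    exact ⟨T', (Finset.subset_insert a T).trans hsub, hc, ht⟩

/-- Domination of tail counts implies that the sorted elements are pointwise dominated. -/
theorem orderIsoOfFin_le_of_tailCount_le {m w : ℕ} {S T : Finset (Fin m)} (hT : T.card = w)
    (hS : S.card = w) (h : ∀ k, tailCount T k ≤ tailCount S k) (q : Fin w) :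
    (T.orderIsoOfFin hT q : Fin m) ≤ (S.orderIsoOfFin hS q : Fin m) := by
  by_contra hlt
  rw [not_le] at hlt
  have hk := h (T.orderIsoOfFin hT q : Fin m)
  have h1 : (Finset.Ici q).card ≤ tailCount T (T.orderIsoOfFin hT q : Fin m) :=
    Finset.card_le_card_of_injOn (fun i => (T.orderIsoOfFin hT i).1)
      (fun i hi => by
        have hi : q ≤ i := by simpa using hi
        have : T.orderIsoOfFin hT q ≤ T.orderIsoOfFin hT i :=
          (T.orderIsoOfFin hT).monotone hi
        exact Finset.mem_filter.2 ⟨(T.orderIsoOfFin hT i).2, this⟩)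
      (fun a _ b _ hab => (T.orderIsoOfFin hT).injective (Subtype.ext hab))
  have h2 : tailCount S (T.orderIsoOfFin hT q : Fin m) ≤ (Finset.Ioi q).card := by
    refine (Finset.card_le_card ?_).trans
      (Finset.card_image_le (s := Finset.Ioi q) (f := fun i => (S.orderIsoOfFin hS i).1))
    intro s hs
    obtain ⟨hsS, hle⟩ := Finset.mem_filter.1 hs
    obtain ⟨i, hi⟩ := (S.orderIsoOfFin hS).surjective ⟨s, hsS⟩
    refine Finset.mem_image.2 ⟨i, ?_, by rw [hi]⟩
    have hlt' : S.orderIsoOfFin hS q < S.orderIsoOfFin hS i := by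
      rw [hi]
      exact Subtype.coe_lt_coe.1 (lt_of_lt_of_le hlt (Fin.le_def.2 hle))
    simpa using (S.orderIsoOfFin hS).lt_iff_lt.1 hlt'
  rw [Fin.card_Ici] at h1
  rw [Fin.card_Ioi] at h2
  have := q.2
  omega

/-- The exponent vector with support `T`. -/
def expVec {m : ℕ} (T : Finset (Fin m)) : Fin m → ZMod 2 := fun i => if i ∈ T then 1 else 0

theorem suppBF_expVec {m : ℕ} (T : Finset (Fin m)) : suppBF (expVec T) = T := by
  ext i
  simp [suppBF, expVec]

theorem monomialBF_apply {m : ℕ} (v x : Fin m → ZMod 2) :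
    monomialBF v x = ∏ i ∈ suppBF v, x i := by
  unfold monomialBF suppBF
  rw [Finset.prod_filter]
  refine Finset.prod_congr rfl fun i _ => ?_
  generalize v i = a
  generalize x i = y
  revert a y
  decide

theorem monLE_of_tailCount_le {m : ℕ} {t v : Fin m → ZMod 2}
    (h : ∀ k, tailCount (suppBF t) k ≤ tailCount (suppBF v) k) : monLE t v := by
  obtain ⟨T', hsub, hc, ht⟩ := exists_superset_tailCount_le _ _ h
  rw [← suppBF_expVec T'] at hsub hc ht
  exact ⟨expVec T', hsub, hc, fun q => orderIsoOfFin_le_of_tailCount_le hc rfl ht q⟩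

/-- The span of the monomials whose support has tail counts dominated by those of `S`. -/
def tailSpan {m : ℕ} (S : Finset (Fin m)) : Submodule (ZMod 2) (BF m) :=
  Submodule.span (ZMod 2)
    {f | ∃ T : Finset (Fin m), (∀ k, tailCount T k ≤ tailCount S k) ∧ f = monomialBF (expVec T)}

theorem coord_mul_monomialBF {m : ℕ} (j : Fin m) (T : Finset (Fin m)) :
    (fun x => x j) * monomialBF (expVec T) = monomialBF (expVec (insert j T)) := by
  funext x
  rw [Pi.mul_apply, monomialBF_apply, monomialBF_apply, suppBF_expVec, suppBF_expVec]
  by_cases hj : j ∈ T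
  · rw [Finset.insert_eq_of_mem hj, ← Finset.mul_prod_erase T x hj, ← mul_assoc]
    congr 1
    generalize x j = y
    revert y
    decide
  · rw [Finset.prod_insert hj]

theorem affine_mul_mem_tailSpan {m : ℕ} {S : Finset (Fin m)} {i : Fin m} (hi : i ∉ S)
    (a : Fin m → ZMod 2) (c : ZMod 2) (ha : ∀ j, i < j → a j = 0) {f : BF m}
    (hf : f ∈ tailSpan S) : (fun x => (∑ j, a j * x j) + c) * f ∈ tailSpan (insert i S) := by
  induction hf using Submodule.span_induction with
  | mem f hf =>
    obtain ⟨T, hT, rfl⟩ := hf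
    have key : (fun x => (∑ j, a j * x j) + c) * monomialBF (expVec T) =
        (∑ j, a j • monomialBF (expVec (insert j T))) + c • monomialBF (expVec T) := by
      funext x
      simp only [← coord_mul_monomialBF, Pi.mul_apply, Pi.add_apply, Finset.sum_apply,
        Pi.smul_apply, smul_eq_mul, add_mul, Finset.sum_mul, mul_assoc]
    rw [key]
    refine add_mem (sum_mem fun j _ => ?_) (Submodule.smul_mem _ _ (Submodule.subset_span
      ⟨T, fun k => ?_, rfl⟩))
    · by_cases hij : i < j
      · rw [ha j hij, zero_smul]
        exact zero_mem _
      · refine Submodule.smul_mem _ _ (Submodule.subset_span ⟨insert j T, fun k => ?_, rfl⟩)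
        have h1 := tailCount_insert_le T j k
        have h2 := tailCount_insert hi k
        have h3 := hT k
        have h4 : (j : ℕ) ≤ i := not_lt.1 hij
        split_ifs at h1 h2 <;> omega
    · have h2 := tailCount_insert hi k
      have h3 := hT k
      omega
  | zero => rw [mul_zero]; exact zero_mem _
  | add f g _ _ hf hg => rw [mul_add]; exact add_mem hf hg
  | smul r f _ hf => rw [mul_smul_comm]; exact Submodule.smul_mem _ _ hf

theorem prod_affine_mem_tailSpan {m : ℕ} (A : Matrix (Fin m) (Fin m) (ZMod 2))
    (b : Fin m → ZMod 2) (hA : ∀ i j : Fin m, i < j → A i j = 0) (S : Finset (Fin m)) :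
    (∏ i ∈ S, fun x : Fin m → ZMod 2 => (∑ j, A i j * x j) + b i) ∈ tailSpan S := by
  induction S using Finset.induction_on with
  | empty =>
    refine Submodule.subset_span ⟨∅, fun _ => le_rfl, ?_⟩
    funext x
    rw [monomialBF_apply, suppBF_expVec]
    simp
  | insert i S hi ih =>
    rw [Finset.prod_insert hi]
    exact affine_mul_mem_tailSpan hi (A i) (b i) (hA i) ih

theorem tailSpan_le_monomialCode {m : ℕ} {V : Set (Fin m → ZMod 2)} (hdec : IsDecreasingSet V)
    {v : Fin m → ZMod 2} (hv : v ∈ V) : tailSpan (suppBF v) ≤ monomialCode V := by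
  refine Submodule.span_le.2 ?_
  rintro _ ⟨T, hT, rfl⟩
  refine Submodule.subset_span ⟨expVec T, hdec v hv _ (monLE_of_tailCount_le ?_), rfl⟩
  rwa [suppBF_expVec]

theorem map_substAff_monomialCode_le {m : ℕ} {V : Set (Fin m → ZMod 2)}
    (hdec : IsDecreasingSet V) (A : Matrix (Fin m) (Fin m) (ZMod 2)) (b : Fin m → ZMod 2)
    (hA : ∀ i j : Fin m, i < j → A i j = 0) :
    Submodule.map (substAff A b) (monomialCode V) ≤ monomialCode V := by
  unfold monomialCode
  rw [Submodule.map_span, Submodule.span_le]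
  rintro _ ⟨_, ⟨v, hv, rfl⟩, rfl⟩
  have key : substAff A b (monomialBF v) =
      ∏ i ∈ suppBF v, fun x : Fin m → ZMod 2 => (∑ j, A i j * x j) + b i := by
    funext x
    change monomialBF v (A.mulVec x + b) = _
    rw [monomialBF_apply, Finset.prod_apply]
    rfl
  rw [key]
  exact tailSpan_le_monomialCode hdec hv (prod_affine_mem_tailSpan A b hA _)

theorem substAff_injective {m : ℕ} (A : Matrix (Fin m) (Fin m) (ZMod 2)) (b : Fin m → ZMod 2)
    (hA : IsUnit A) : Function.Injective (substAff A b) := by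
  intro f g hfg
  funext y
  obtain ⟨x, hx⟩ := Matrix.mulVec_surjective_iff_isUnit.2 hA (y - b)
  have h : f (A.mulVec x + b) = g (A.mulVec x + b) := congrFun hfg x
  rwa [hx, sub_add_cancel] at h

/-- Let `V ⊆ 𝔽₂^m` be a decreasing set of exponent vectors.  Then the
monomial code `C(V)` is invariant under every affine permutation `x ↦ Ax + b` of `𝔽₂^m` with
`A` invertible and lower-triangular (`A i j = 0` for `j > i`): the substitution
`f(x) ↦ f(Ax + b)` maps `C(V)` onto itself. -/
theorem decreasing_monomialCode_LTA_invariant (m : ℕ) (V : Set (Fin m → ZMod 2))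
    (hdec : IsDecreasingSet V) :
    ∀ (A : Matrix (Fin m) (Fin m) (ZMod 2)) (b : Fin m → ZMod 2),
      IsUnit A → (∀ i j : Fin m, i < j → A i j = 0) →
      Submodule.map (substAff A b) (monomialCode V) = monomialCode V := by
  intro A b hA hlow
  exact Submodule.eq_of_le_of_finrank_eq (map_substAff_monomialCode_le hdec A b hlow)
    (Submodule.equivMapOfInjective _ (substAff_injective A b hA) _).finrank_eq.symm
end
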